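/- arXiv:1408.3021 — 2 statements merged into one kernel-verified Lean document; each statement's English description precedes it below -/
import Mathlib

section
/- Let g : ℝ³ → ℝ be smooth with compact support. Then the Newtonian potential φ(x) = (1/(4π)) ∫_{ℝ³} g(y)/|x − y| dy is twice continuously differentiable on ℝ³ and satisfies Δφ(x) = −g(x) for every x ∈ ℝ³, where Δφ is the sum of the second partial derivatives of φ. -/
open MeasureTheory

/-- The Laplacian of `u : ℝ³ → ℝ`, defined as the sum of the second partial derivatives. -/
noncomputable def lap3 (u : EuclideanSpace ℝ (Fin 3) → ℝ) (x : EuclideanSpace ℝ (Fin 3)) : ℝ :=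
  ∑ i : Fin 3,
    fderiv ℝ (fun y => fderiv ℝ u y (EuclideanSpace.single i (1:ℝ))) x
      (EuclideanSpace.single i (1:ℝ))

/-- The Newtonian potential of `g : ℝ³ → ℝ`. -/
noncomputable def newtonPot (g : EuclideanSpace ℝ (Fin 3) → ℝ)
    (x : EuclideanSpace ℝ (Fin 3)) : ℝ :=
  (1 / (4 * Real.pi)) * ∫ y : EuclideanSpace ℝ (Fin 3), g y / ‖x - y‖

open Filter Topology Set Module

open scoped Convolution

/-! ### Radial kernels -/

lemma integral_Ioi_sq_mul_one_add_sq_rpow :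
    ∫ r in Ioi (0 : ℝ), r ^ 2 * (3 * (1 + r ^ 2) ^ (-5 / 2 : ℝ)) = 1 := by
  have hderiv : ∀ r : ℝ, HasDerivAt (fun r : ℝ => r ^ 3 * (1 + r ^ 2) ^ (-3 / 2 : ℝ))
      (r ^ 2 * (3 * (1 + r ^ 2) ^ (-5 / 2 : ℝ))) r := by
    intro r
    have hpos : 0 < 1 + r ^ 2 := by positivity
    have h₁ : HasDerivAt (fun r : ℝ => 1 + r ^ 2) (2 * r) r := by
      simpa using (hasDerivAt_pow 2 r).const_add 1
    have h₂ := (hasDerivAt_pow 3 r).mul (h₁.rpow_const (p := (-3 / 2 : ℝ)) (Or.inl hpos.ne'))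
    refine h₂.congr_deriv ?_
    have e₁ : (-3 / 2 - 1 : ℝ) = -5 / 2 := by norm_num
    have e₂ : (1 + r ^ 2) ^ (-3 / 2 : ℝ) = (1 + r ^ 2) ^ (-5 / 2 : ℝ) * (1 + r ^ 2) := by
      rw [← Real.rpow_add_one hpos.ne']; norm_num
    rw [e₁, e₂]
    push_cast
    ring
  have hlim : Tendsto (fun r : ℝ => r ^ 3 * (1 + r ^ 2) ^ (-3 / 2 : ℝ)) atTop (𝓝 1) := by
    have h₁ : Tendsto (fun r : ℝ => 1 - (1 + r ^ 2)⁻¹) atTop (𝓝 (1 - 0)) :=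
      tendsto_const_nhds.sub (tendsto_inv_atTop_zero.comp
        (tendsto_atTop_add_const_left _ _ (tendsto_pow_atTop two_ne_zero)))
    have h₂ := h₁.rpow_const (p := (3 / 2 : ℝ)) (Or.inl (by norm_num))
    rw [sub_zero, Real.one_rpow] at h₂
    refine h₂.congr' ?_
    filter_upwards [eventually_gt_atTop 0] with r hr
    have hpos : 0 < 1 + r ^ 2 := by positivity
    have e : 1 - (1 + r ^ 2)⁻¹ = r ^ 2 / (1 + r ^ 2) := by field_simp; ring
    rw [e, Real.div_rpow (by positivity) hpos.le, ← Real.rpow_natCast_mul hr.le,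
      neg_div, Real.rpow_neg hpos.le, div_eq_mul_inv]
    norm_num
  rw [integral_Ioi_of_hasDerivAt_of_nonneg (hderiv 0).continuousAt.continuousWithinAt
    (fun r _ => hderiv r) (fun r _ => by positivity) hlim]
  simp

lemma integral_one_add_norm_sq_rpow :
    ∫ x : EuclideanSpace ℝ (Fin 3), 3 * (1 + ‖x‖ ^ 2) ^ (-5 / 2 : ℝ) = 4 * Real.pi := by
  rw [integral_fun_norm_addHaar volume (fun r => 3 * (1 + r ^ 2) ^ (-5 / 2 : ℝ))]
  simp only [finrank_euclideanSpace, Fintype.card_fin, Measure.real,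
    EuclideanSpace.volume_ball_fin_three, smul_eq_mul, nsmul_eq_mul, Nat.add_one_sub_one]
  rw [integral_Ioi_sq_mul_one_add_sq_rpow]
  rw [ENNReal.ofReal_one, one_pow, one_mul, ENNReal.toReal_ofReal (by positivity)]
  push_cast
  ring

lemma integrable_one_add_norm_sq_rpow :
    Integrable fun x : EuclideanSpace ℝ (Fin 3) => (1 + ‖x‖ ^ 2) ^ (-5 / 2 : ℝ) :=
  integrable_rpow_neg_one_add_norm_sq (by simp; norm_num)

lemma locallyIntegrable_inv_norm :
    LocallyIntegrable fun x : EuclideanSpace ℝ (Fin 3) => ‖x‖⁻¹ :=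
  locallyIntegrable_of_norm_le_rpow (C := 1) (α := 1) (by simp) (by simp)
    (Eventually.of_forall fun x => by simp [Real.rpow_neg_one])
    (by fun_prop)

section InnerProductSpace

variable {E : Type*} [NormedAddCommGroup E] [InnerProductSpace ℝ E] {c : ℝ}

lemma contDiff_add_norm_sq_rpow {n : WithTop ℕ∞} (hc : 0 < c) (p : ℝ) :
    ContDiff ℝ n fun x : E => (c + ‖x‖ ^ 2) ^ p :=
  (contDiff_const.add (contDiff_norm_sq ℝ)).rpow_const_of_ne fun x => by positivity

lemma hasFDerivAt_add_norm_sq_rpow (hc : 0 < c) (p : ℝ) (x : E) :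
    HasFDerivAt (fun x : E => (c + ‖x‖ ^ 2) ^ p)
      ((p * (c + ‖x‖ ^ 2) ^ (p - 1)) • (2 • innerSL ℝ x)) x :=
  ((hasStrictFDerivAt_norm_sq x).hasFDerivAt.const_add c).rpow_const
    (Or.inl (by positivity))

end InnerProductSpace

lemma lap3_add_norm_sq_rpow {c : ℝ} (hc : 0 < c) (x : EuclideanSpace ℝ (Fin 3)) :
    lap3 (fun y => (c + ‖y‖ ^ 2) ^ (-1 / 2 : ℝ)) x =
      -(c * (3 * (c + ‖x‖ ^ 2) ^ (-5 / 2 : ℝ))) := by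
  have hpos : 0 < c + ‖x‖ ^ 2 := by positivity
  have hfirst (i : Fin 3) : (fun y : EuclideanSpace ℝ (Fin 3) =>
      fderiv ℝ (fun y => (c + ‖y‖ ^ 2) ^ (-1 / 2 : ℝ)) y (EuclideanSpace.single i (1 : ℝ))) =
      fun y => -(y i * (c + ‖y‖ ^ 2) ^ (-3 / 2 : ℝ)) := by
    ext y
    rw [(hasFDerivAt_add_norm_sq_rpow hc _ y).fderiv]
    simp [EuclideanSpace.inner_single_right]
    norm_num
    ring
  have hsecond (i : Fin 3) : fderiv ℝ (fun y : EuclideanSpace ℝ (Fin 3) =>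
      -(y i * (c + ‖y‖ ^ 2) ^ (-3 / 2 : ℝ))) x (EuclideanSpace.single i (1 : ℝ)) =
      3 * (x i) ^ 2 * (c + ‖x‖ ^ 2) ^ (-5 / 2 : ℝ) - (c + ‖x‖ ^ 2) ^ (-3 / 2 : ℝ) := by
    have h := (((EuclideanSpace.proj (𝕜 := ℝ) i).hasFDerivAt (x := x)).mul
      (hasFDerivAt_add_norm_sq_rpow hc (-3 / 2) x)).neg
    have h' := h.fderiv
    have e₁ : (-3 / 2 - 1 : ℝ) = -5 / 2 := by norm_num
    rw [e₁] at h'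
    refine (DFunLike.congr_fun h' _).trans ?_
    simp [EuclideanSpace.inner_single_right]
    ring
  have e₂ : (c + ‖x‖ ^ 2) ^ (-3 / 2 : ℝ) = (c + ‖x‖ ^ 2) ^ (-5 / 2 : ℝ) * (c + ‖x‖ ^ 2) := by
    rw [← Real.rpow_add_one hpos.ne']; norm_num
  simp only [lap3, hfirst, hsecond, e₂]
  have hn : ‖x‖ ^ 2 = x 0 ^ 2 + x 1 ^ 2 + x 2 ^ 2 := by
    simp [EuclideanSpace.norm_sq_eq, Fin.sum_univ_three]
  simp only [Fin.sum_univ_three]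
  linear_combination (3 * (c + ‖x‖ ^ 2) ^ (-5 / 2 : ℝ)) * (-hn)

/-! ### Integration by parts -/

section Directional

variable {E : Type*} [NormedAddCommGroup E] [NormedSpace ℝ E] {f k h : E → ℝ}

lemma ContDiff.fderiv_apply_const {n m : WithTop ℕ∞} (hf : ContDiff ℝ n f) (hmn : m + 1 ≤ n)
    (v : E) : ContDiff ℝ m fun x => fderiv ℝ f x v :=
  (hf.fderiv_right hmn).clm_apply contDiff_const

variable [FiniteDimensional ℝ E] [MeasurableSpace E] [BorelSpace E] {μ : Measure E}
  [μ.IsAddHaarMeasure]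

lemma integral_mul_fderiv_eq_neg_of_hasCompactSupport (hk : ContDiff ℝ 1 k)
    (hh : ContDiff ℝ 1 h) (hsupp : HasCompactSupport h) (v : E) :
    ∫ x, k x * fderiv ℝ h x v ∂μ = -∫ x, fderiv ℝ k x v * h x ∂μ := by
  have hk' := (hk.fderiv_apply_const (m := 0) (by simp) v).continuous
  have hh' := (hh.fderiv_apply_const (m := 0) (by simp) v).continuous
  exact integral_mul_fderiv_eq_neg_fderiv_mul_of_integrable
    ((hk'.mul hh.continuous).integrable_of_hasCompactSupport hsupp.mul_left)
    ((hk.continuous.mul hh').integrable_of_hasCompactSupport (hsupp.fderiv_apply ℝ v).mul_left)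
    ((hk.continuous.mul hh.continuous).integrable_of_hasCompactSupport hsupp.mul_left)
    (fun x _ => hk.differentiable one_ne_zero x) (fun x _ => hh.differentiable one_ne_zero x)

lemma integral_mul_fderiv_fderiv_of_hasCompactSupport (hk : ContDiff ℝ 2 k)
    (hh : ContDiff ℝ 2 h) (hsupp : HasCompactSupport h) (v : E) :
    ∫ x, k x * fderiv ℝ (fun y => fderiv ℝ h y v) x v ∂μ =
      ∫ x, fderiv ℝ (fun y => fderiv ℝ k y v) x v * h x ∂μ := by
  have h12 : (1 : WithTop ℕ∞) ≤ 2 := one_le_two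
  have h11 : (1 : WithTop ℕ∞) + 1 ≤ 2 := one_add_one_eq_two.le
  rw [integral_mul_fderiv_eq_neg_of_hasCompactSupport (hk.of_le h12)
      (hh.fderiv_apply_const h11 v) (hsupp.fderiv_apply ℝ v),
    integral_mul_fderiv_eq_neg_of_hasCompactSupport (hk.fderiv_apply_const h11 v)
      (hh.of_le h12) hsupp, neg_neg]

end Directional

section Laplacian

variable {k h : EuclideanSpace ℝ (Fin 3) → ℝ}

lemma continuous_fderiv_fderiv_single (hh : ContDiff ℝ 2 h) (v : EuclideanSpace ℝ (Fin 3)) :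
    Continuous fun x => fderiv ℝ (fun y => fderiv ℝ h y v) x v :=
  ((hh.fderiv_apply_const (m := 1) one_add_one_eq_two.le v).fderiv_apply_const
    (m := 0) (by simp) v).continuous

lemma continuous_lap3 (hh : ContDiff ℝ 2 h) : Continuous (lap3 h) :=
  continuous_finsetSum _ fun _ _ => continuous_fderiv_fderiv_single hh _

lemma HasCompactSupport.lap3 (hsupp : HasCompactSupport h) : HasCompactSupport (lap3 h) := by
  have hi (i : Fin 3) := (hsupp.fderiv_apply ℝ (EuclideanSpace.single i (1 : ℝ))).fderiv_apply ℝ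
    (EuclideanSpace.single i (1 : ℝ))
  have hsum := ((hi 0).add (hi 1)).add (hi 2)
  rwa [show _root_.lap3 h = _ from funext fun x => Fin.sum_univ_three _]

lemma integral_mul_lap3 (hk : ContDiff ℝ 2 k) (hh : ContDiff ℝ 2 h)
    (hsupp : HasCompactSupport h) :
    ∫ x, k x * lap3 h x = ∫ x, lap3 k x * h x := by
  simp only [lap3, Finset.mul_sum, Finset.sum_mul]
  rw [integral_finsetSum, integral_finsetSum]
  · exact Finset.sum_congr rfl fun i _ =>
      integral_mul_fderiv_fderiv_of_hasCompactSupport hk hh hsupp _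
  · exact fun i _ => ((continuous_fderiv_fderiv_single hk _).mul
      hh.continuous).integrable_of_hasCompactSupport hsupp.mul_left
  · exact fun i _ => (hk.continuous.mul
      (continuous_fderiv_fderiv_single hh _)).integrable_of_hasCompactSupport
      ((hsupp.fderiv_apply ℝ _).fderiv_apply ℝ _).mul_left

/-- The regularised kernel `(ε² + ‖x‖²)^(-1/2)` tested against `lap3 h`, after rescaling. -/
lemma integral_regularized_mul_lap3 (hh : ContDiff ℝ 2 h) (hsupp : HasCompactSupport h)
    {ε : ℝ} (hε : 0 < ε) :
    ∫ x, (ε ^ 2 + ‖x‖ ^ 2) ^ (-1 / 2 : ℝ) * lap3 h x =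
      -∫ x, 3 * (1 + ‖x‖ ^ 2) ^ (-5 / 2 : ℝ) * h (ε • x) := by
  have hε2 : 0 < ε ^ 2 := by positivity
  rw [integral_mul_lap3 (contDiff_add_norm_sq_rpow hε2 _) hh hsupp]
  simp only [lap3_add_norm_sq_rpow hε2, neg_mul, integral_neg]
  have hscale := Measure.integral_comp_smul_of_nonneg volume
    (fun x => ε ^ 2 * (3 * (ε ^ 2 + ‖x‖ ^ 2) ^ (-5 / 2 : ℝ)) * h x) ε (hR := hε.le)
  rw [finrank_euclideanSpace, Fintype.card_fin, smul_eq_mul, eq_inv_mul_iff_mul_eq₀ (by positivity),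
    ← integral_const_mul] at hscale
  rw [← hscale]
  congr 1
  refine integral_congr_ae (Eventually.of_forall fun x => ?_)
  have e : ε ^ 2 + ‖ε • x‖ ^ 2 = ε ^ 2 * (1 + ‖x‖ ^ 2) := by
    rw [norm_smul, Real.norm_of_nonneg hε.le]; ring
  have e' : (ε ^ 2) ^ (-5 / 2 : ℝ) = (ε ^ 5)⁻¹ := by
    rw [← Real.rpow_natCast_mul hε.le, ← Real.rpow_natCast, ← Real.rpow_neg hε.le]
    norm_num
  simp only [e]
  rw [Real.mul_rpow hε2.le (by positivity), e']
  field_simp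

lemma integral_inv_norm_mul_lap3 (hh : ContDiff ℝ 2 h) (hsupp : HasCompactSupport h) :
    ∫ x, ‖x‖⁻¹ * lap3 h x = -(4 * Real.pi * h 0) := by
  have hlap := continuous_lap3 hh
  have hleft : Tendsto (fun ε : ℝ => ∫ x, (ε ^ 2 + ‖x‖ ^ 2) ^ (-1 / 2 : ℝ) * lap3 h x)
      (𝓝[>] 0) (𝓝 (∫ x, ‖x‖⁻¹ * lap3 h x)) := by
    have hsqrt (x : EuclideanSpace ℝ (Fin 3)) : (‖x‖ ^ 2) ^ (-1 / 2 : ℝ) = ‖x‖⁻¹ := by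
      rw [← Real.rpow_natCast_mul (norm_nonneg x)]
      norm_num [Real.rpow_neg_one]
    have hae : ∀ᵐ x : EuclideanSpace ℝ (Fin 3), x ≠ 0 := by
      simp [ae_iff]
    refine tendsto_integral_filter_of_dominated_convergence (fun x => ‖x‖⁻¹ * ‖lap3 h x‖) ?_ ?_ ?_ ?_
    · filter_upwards [self_mem_nhdsWithin] with ε hε
      have hε2 : 0 < ε ^ 2 := pow_pos hε 2
      exact ((contDiff_add_norm_sq_rpow (n := 0) hε2 _).continuous.mul hlap).aestronglyMeasurable
    · filter_upwards with ε
      filter_upwards [hae] with x hx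
      have hx' : 0 < ‖x‖ := norm_pos_iff.2 hx
      rw [norm_mul, Real.norm_of_nonneg (by positivity), ← hsqrt]
      gcongr ?_ * _
      exact Real.rpow_le_rpow_of_nonpos (by positivity) (by nlinarith) (by norm_num)
    · exact (locallyIntegrable_inv_norm.integrable_smul_right_of_hasCompactSupport
        hlap.norm hsupp.lap3.norm)
    · filter_upwards [hae] with x hx
      have hx' : 0 < ‖x‖ := norm_pos_iff.2 hx
      rw [← hsqrt]
      have hc : ContinuousAt (fun ε : ℝ => (ε ^ 2 + ‖x‖ ^ 2) ^ (-1 / 2 : ℝ) * lap3 h x) 0 :=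
        (ContinuousAt.rpow_const (by fun_prop) (Or.inl (by positivity))).mul continuousAt_const
      have := hc.tendsto.mono_left (nhdsWithin_le_nhds (s := Ioi 0))
      simpa using this
  have hright : Tendsto (fun ε : ℝ => ∫ x, 3 * (1 + ‖x‖ ^ 2) ^ (-5 / 2 : ℝ) * h (ε • x))
      (𝓝[>] 0) (𝓝 (∫ x : EuclideanSpace ℝ (Fin 3), 3 * (1 + ‖x‖ ^ 2) ^ (-5 / 2 : ℝ) * h 0)) := by
    obtain ⟨C, hC⟩ := hsupp.exists_bound_of_continuous hh.continuous
    have hker := integrable_one_add_norm_sq_rpow.const_mul 3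
    refine tendsto_integral_filter_of_dominated_convergence
      (fun x => 3 * (1 + ‖x‖ ^ 2) ^ (-5 / 2 : ℝ) * C) ?_ ?_ (hker.mul_const C) ?_
    · filter_upwards with ε
      exact hker.aestronglyMeasurable.mul
        (hh.continuous.comp (continuous_const_smul ε)).aestronglyMeasurable
    · filter_upwards with ε
      filter_upwards with x
      rw [norm_mul, Real.norm_of_nonneg (by positivity)]
      gcongr
      exact hC _
    · filter_upwards with x
      have hc : Continuous fun ε : ℝ => 3 * (1 + ‖x‖ ^ 2) ^ (-5 / 2 : ℝ) * h (ε • x) :=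
        continuous_const.mul (hh.continuous.comp (by fun_prop))
      simpa using hc.continuousAt.tendsto.mono_left (nhdsWithin_le_nhds (a := 0) (s := Ioi 0))
  have heq : ∫ x, ‖x‖⁻¹ * lap3 h x =
      -∫ x : EuclideanSpace ℝ (Fin 3), 3 * (1 + ‖x‖ ^ 2) ^ (-5 / 2 : ℝ) * h 0 :=
    tendsto_nhds_unique_of_eventuallyEq hleft hright.neg <| by
      filter_upwards [self_mem_nhdsWithin] with ε hε
      exact integral_regularized_mul_lap3 hh hsupp hε
  rw [heq, integral_mul_const, integral_one_add_norm_sq_rpow]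

/-! ### The Newtonian potential as a convolution -/

lemma fderiv_comp_const_sub_apply (f : EuclideanSpace ℝ (Fin 3) → ℝ)
    (x y v : EuclideanSpace ℝ (Fin 3)) :
    fderiv ℝ (fun z => f (x - z)) y v = -fderiv ℝ f (x - y) v := by
  have h := (ContinuousLinearEquiv.neg ℝ (M := EuclideanSpace ℝ (Fin 3))).comp_right_fderiv
    (f := fun z => f (x + z)) (x := y)
  rw [fderiv_comp_add_left] at h
  simpa [Function.comp_def, ← sub_eq_add_neg] using DFunLike.congr_fun h v

lemma lap3_comp_const_sub (f : EuclideanSpace ℝ (Fin 3) → ℝ) (x y : EuclideanSpace ℝ (Fin 3)) :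
    lap3 (fun z => f (x - z)) y = lap3 f (x - y) := by
  simp only [lap3, fderiv_comp_const_sub_apply]
  refine Finset.sum_congr rfl fun i _ => ?_
  rw [fderiv_fun_neg, neg_apply,
    fderiv_comp_const_sub_apply
      (fun z => fderiv ℝ f z (EuclideanSpace.single i (1 : ℝ))) x y, neg_neg]

lemma newtonPot_eq_convolution (g : EuclideanSpace ℝ (Fin 3) → ℝ) :
    newtonPot g = fun x => (1 / (4 * Real.pi)) *
      ((fun y : EuclideanSpace ℝ (Fin 3) => ‖y‖⁻¹) ⋆[ContinuousLinearMap.mul ℝ ℝ] g) x := by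
  ext x
  rw [convolution_eq_swap, newtonPot]
  simp [div_eq_inv_mul]

lemma contDiff_newtonPot {n : ℕ∞} (hh : ContDiff ℝ n h) (hsupp : HasCompactSupport h) :
    ContDiff ℝ n (newtonPot h) := by
  rw [newtonPot_eq_convolution]
  exact contDiff_const.mul (hsupp.contDiff_convolution_right _ locallyIntegrable_inv_norm hh)

lemma fderiv_newtonPot_apply (hh : ContDiff ℝ 1 h) (hsupp : HasCompactSupport h)
    (x v : EuclideanSpace ℝ (Fin 3)) :
    fderiv ℝ (newtonPot h) x v = newtonPot (fun y => fderiv ℝ h y v) x := by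
  rw [newtonPot_eq_convolution, newtonPot_eq_convolution,
    ((hsupp.hasFDerivAt_convolution_right (ContinuousLinearMap.mul ℝ ℝ)
      locallyIntegrable_inv_norm hh x).const_mul _).fderiv]
  rw [smul_apply, convolution_precompR_apply _ locallyIntegrable_inv_norm
    (hsupp.fderiv ℝ) (hh.continuous_fderiv one_ne_zero), smul_eq_mul]

lemma lap3_newtonPot (hh : ContDiff ℝ 2 h) (hsupp : HasCompactSupport h)
    (x : EuclideanSpace ℝ (Fin 3)) : lap3 (newtonPot h) x = newtonPot (lap3 h) x := by
  have hterm (v : EuclideanSpace ℝ (Fin 3)) :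
      fderiv ℝ (fun y => fderiv ℝ (newtonPot h) y v) x v =
        newtonPot (fun z => fderiv ℝ (fun y => fderiv ℝ h y v) z v) x := by
    simp only [fderiv_newtonPot_apply (hh.of_le one_le_two) hsupp]
    exact fderiv_newtonPot_apply (hh.fderiv_apply_const one_add_one_eq_two.le v)
      (hsupp.fderiv_apply ℝ v) x v
  simp only [lap3, hterm]
  simp only [newtonPot_eq_convolution, ← Finset.mul_sum, convolution_def,
    ContinuousLinearMap.mul_apply']
  rw [← integral_finsetSum]
  · simp only [lap3, Finset.mul_sum]
  exact fun i _ => ((hsupp.fderiv_apply ℝ _).fderiv_apply ℝ _).convolutionExists_right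
    (ContinuousLinearMap.mul ℝ ℝ) locallyIntegrable_inv_norm
    (continuous_fderiv_fderiv_single hh _) x

end Laplacian

/-- If `g : ℝ³ → ℝ` is smooth with compact support, then its Newtonian
potential `φ(x) = (1/(4π)) ∫ g(y)/|x - y| dy` is twice continuously differentiable and
satisfies `Δφ = -g` pointwise on `ℝ³`. -/
theorem newtonPot_laplacian
    (g : EuclideanSpace ℝ (Fin 3) → ℝ)
    (hg : ContDiff ℝ (⊤ : ℕ∞) g) (hgsupp : HasCompactSupport g) :
    ContDiff ℝ 2 (newtonPot g) ∧ ∀ x, lap3 (newtonPot g) x = -g x := by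
  have hg2 : ContDiff ℝ 2 g := hg.of_le (WithTop.coe_le_coe.2 le_top)
  refine ⟨contDiff_newtonPot (n := 2) hg2 hgsupp, fun x => ?_⟩
  have hrefl : ContDiff ℝ 2 fun z => g (x - z) := hg2.comp (contDiff_const.sub contDiff_id)
  have hreflsupp : HasCompactSupport fun z => g (x - z) :=
    hgsupp.comp_homeomorph (Homeomorph.subLeft x)
  have hmain := integral_inv_norm_mul_lap3 hrefl hreflsupp
  simp only [lap3_comp_const_sub, sub_zero] at hmain
  rw [lap3_newtonPot hg2 hgsupp, newtonPot_eq_convolution]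
  simp only [convolution_def, ContinuousLinearMap.mul_apply', hmain]
  have := Real.pi_ne_zero
  field_simp
end

section
/- Let f : ℝ → ℝ be C¹ satisfying (f₁)–(f₄) and let V : ℝ³ → ℝ be measurable with 0 < α ≤ V(x) ≤ V_∞ for all x. Let v : ℝ³ → ℝ be continuously differentiable with compact support, with v⁺ = max(v,0) ≠ 0 and v⁻ = min(v,0) ≠ 0. Set a⁺ = ∫_{{v>0}}(|∇v|² + V v²) dx, a⁻ = ∫_{{v<0}}(|∇v|² + V v²) dx, and D(g,h) = (1/(4π)) ∫∫ g(x)² h(y)² / |x − y| dx dy. Then there exist t, s > 0 such that t² a⁺ + t⁴ D(v⁺,v⁺) + t² s² D(v⁺,v⁻) = ∫ f(t v⁺) t v⁺ dx and s² a⁻ + s⁴ D(v⁻,v⁻) + t² s² D(v⁻,v⁺) = ∫ f(s v⁻) s v⁻ dx. Moreover, if a⁺ + D(v⁺,v⁺) + D(v⁺,v⁻) ≤ ∫ f(v⁺) v⁺ dx and a⁻ + D(v⁻,v⁻) + D(v⁻,v⁺) ≤ ∫ f(v⁻) v⁻ dx, then t ≤ 1 and s ≤ 1. -/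
open MeasureTheory Filter Topology intervalIntegral

/-- The Coulomb interaction energy
`D(g,h) = (1/(4π)) ∫∫ g(x)² h(y)² / |x - y| dx dy`. -/
noncomputable def Dcoul (g h : EuclideanSpace ℝ (Fin 3) → ℝ) : ℝ :=
  (1 / (4 * Real.pi)) *
    ∫ x : EuclideanSpace ℝ (Fin 3), ∫ y : EuclideanSpace ℝ (Fin 3),
      (g x) ^ 2 * (h y) ^ 2 / ‖x - y‖

/-- Properties of a fibering map `t ↦ ∫ f (t u) (t u)` attached to a nonlinearity which is
superlinear at zero and 4-superlinear at infinity. -/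
structure IsFiberMap (H : ℝ → ℝ) : Prop where
  continuous : Continuous H
  div_pow_four_mono : ∀ ⦃t t' : ℝ⦄, 0 < t → t ≤ t' → H t / t ^ 4 ≤ H t' / t' ^ 4
  tendsto_div_sq : Tendsto (fun t => H t / t ^ 2) (𝓝[>] 0) (𝓝 0)
  tendsto_div_pow_four : Tendsto (fun t => H t / t ^ 4) atTop atTop

namespace IsFiberMap

variable {H : ℝ → ℝ} {A A' b t t' : ℝ}

theorem exists_root (hH : IsFiberMap H) (hA : 0 < A) (hb : 0 ≤ b) :
    ∃ t > 0, t ^ 2 * A + t ^ 4 * b = H t := by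
  obtain ⟨r, hr, hr0⟩ := ((hH.tendsto_div_sq.eventually_lt_const hA).and
    self_mem_nhdsWithin).exists
  replace hr0 : 0 < r := hr0
  obtain ⟨R, hR, hrR, hR1⟩ := ((hH.tendsto_div_pow_four.eventually_ge_atTop (A + b)).and
    ((eventually_ge_atTop r).and (eventually_ge_atTop 1))).exists
  have hlow : H r ≤ r ^ 2 * A + r ^ 4 * b := by
    rw [div_lt_iff₀ (by positivity)] at hr
    nlinarith [mul_nonneg (pow_nonneg hr0.le 4) hb]
  have hup : R ^ 2 * A + R ^ 4 * b ≤ H R := by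
    rw [le_div_iff₀ (by positivity)] at hR
    have : R ^ 2 ≤ R ^ 4 := pow_le_pow_right₀ hR1 (by norm_num)
    nlinarith
  have hcont : ContinuousOn (fun t => H t - (t ^ 2 * A + t ^ 4 * b)) (Set.Icc r R) := by
    have := hH.continuous
    fun_prop
  obtain ⟨t, ht, h0⟩ := intermediate_value_Icc hrR hcont
    (show (0 : ℝ) ∈ _ from ⟨by linarith, by linarith⟩)
  exact ⟨t, hr0.trans_le ht.1, by simp only at h0; linarith⟩

/-- Subsolutions of the fiber equation lie below supersolutions. -/
theorem le_of_sub_super (hH : IsFiberMap H) (hA : 0 < A) (hAA' : A ≤ A') (ht : 0 < t)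
    (ht' : 0 < t') (h : H t ≤ t ^ 2 * A + t ^ 4 * b)
    (h' : t' ^ 2 * A' + t' ^ 4 * b ≤ H t') : t ≤ t' := by
  by_contra! hlt
  have hmono := hH.div_pow_four_mono ht' hlt.le
  have h1 : H t / t ^ 4 ≤ A / t ^ 2 + b := by
    rw [div_le_iff₀ (by positivity)]
    calc H t ≤ t ^ 2 * A + t ^ 4 * b := h
      _ = _ := by field_simp
  have h2 : A' / t' ^ 2 + b ≤ H t' / t' ^ 4 := by
    rw [le_div_iff₀ (by positivity)]
    calc _ = t' ^ 2 * A' + t' ^ 4 * b := by field_simp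
      _ ≤ _ := h'
  have h3 : A / t ^ 2 < A / t' ^ 2 :=
    div_lt_div_of_pos_left hA (by positivity) (pow_lt_pow_left₀ hlt ht'.le (by norm_num))
  have h4 : A / t' ^ 2 ≤ A' / t' ^ 2 := by gcongr
  linarith

/-- A solution at which the coupling is at most its diagonal value is bounded by any diagonal
supersolution. -/
theorem le_one_of_coupled {a c s : ℝ} (hH : IsFiberMap H) (ha : 0 < a) (hc : 0 ≤ c)
    (ht : 0 < t) (hs : 0 < s) (hst : s ≤ t)
    (h : t ^ 2 * a + t ^ 4 * b + t ^ 2 * s ^ 2 * c = H t) (h1 : a + b + c ≤ H 1) : t ≤ 1 := by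
  refine hH.le_of_sub_super (b := b + c) ha le_rfl ht one_pos ?_ (by linarith)
  have : s ^ 2 ≤ t ^ 2 := pow_le_pow_left₀ hs.le hst 2
  have : t ^ 2 * s ^ 2 * c ≤ t ^ 2 * t ^ 2 * c := by gcongr
  nlinarith

end IsFiberMap

theorem exists_fixedPoint_of_monotoneOn_Icc {h : ℝ → ℝ} {l r : ℝ} (hlr : l ≤ r)
    (hmono : MonotoneOn h (Set.Icc l r)) (hmaps : Set.MapsTo h (Set.Icc l r) (Set.Icc l r)) :
    ∃ t ∈ Set.Icc l r, h t = t := by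
  have : Fact (l ≤ r) := ⟨hlr⟩
  let φ : Set.Icc l r →o Set.Icc l r :=
    ⟨fun x => ⟨h x, hmaps x.2⟩, fun x y hxy => hmono x.2 y.2 hxy⟩
  exact ⟨φ.lfp, φ.lfp.2, congrArg Subtype.val φ.map_lfp⟩

theorem exists_coupled_root {H₁ H₂ : ℝ → ℝ} (hH₁ : IsFiberMap H₁) (hH₂ : IsFiberMap H₂)
    {a₁ b₁ c₁ a₂ b₂ c₂ : ℝ} (ha₁ : 0 < a₁) (hb₁ : 0 ≤ b₁) (hc₁ : 0 ≤ c₁)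
    (ha₂ : 0 < a₂) (hb₂ : 0 ≤ b₂) (hc₂ : 0 ≤ c₂) :
    ∃ t > 0, ∃ s > 0, t ^ 2 * a₁ + t ^ 4 * b₁ + t ^ 2 * s ^ 2 * c₁ = H₁ t ∧
      s ^ 2 * a₂ + s ^ 4 * b₂ + t ^ 2 * s ^ 2 * c₂ = H₂ s := by
  have hpos₁ (s : ℝ) : 0 < a₁ + s ^ 2 * c₁ := by positivity
  have hpos₂ (t : ℝ) : 0 < a₂ + t ^ 2 * c₂ := by positivity
  choose τ hτ0 hτ using fun s => hH₁.exists_root (hpos₁ s) hb₁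
  choose σ hσ0 hσ using fun t => hH₂.exists_root (hpos₂ t) hb₂
  obtain ⟨R, hR₁, hR₂, hR⟩ := ((hH₁.tendsto_div_pow_four.eventually_ge_atTop (a₁ + b₁ + c₁)).and
    ((hH₂.tendsto_div_pow_four.eventually_ge_atTop (a₂ + b₂ + c₂)).and
    (eventually_ge_atTop 1))).exists
  have hR0 : 0 < R := by linarith
  have hR24 : R ^ 2 ≤ R ^ 4 := pow_le_pow_right₀ hR (by norm_num)
  rw [le_div_iff₀ (by positivity)] at hR₁ hR₂
  have hsq {x y : ℝ} (hx : 0 ≤ x) (hxy : x ≤ y) {c : ℝ} (hc : 0 ≤ c) (a : ℝ) :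
      a + x ^ 2 * c ≤ a + y ^ 2 * c := by gcongr
  have hτR {s : ℝ} (h0 : 0 ≤ s) (hs : s ≤ R) : τ s ≤ R :=
    hH₁.le_of_sub_super (hpos₁ s) (hsq h0 hs hc₁ a₁) (hτ0 s) hR0 (hτ s).ge (by nlinarith)
  have hσR {t : ℝ} (h0 : 0 ≤ t) (ht : t ≤ R) : σ t ≤ R :=
    hH₂.le_of_sub_super (hpos₂ t) (hsq h0 ht hc₂ a₂) (hσ0 t) hR0 (hσ t).ge (by nlinarith)
  have hτm {s s' : ℝ} (h0 : 0 ≤ s) (h : s ≤ s') : τ s ≤ τ s' :=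
    hH₁.le_of_sub_super (hpos₁ s) (hsq h0 h hc₁ a₁) (hτ0 s) (hτ0 s') (hτ s).ge (hτ s').le
  have hσm {t t' : ℝ} (h0 : 0 ≤ t) (h : t ≤ t') : σ t ≤ σ t' :=
    hH₂.le_of_sub_super (hpos₂ t) (hsq h0 h hc₂ a₂) (hσ0 t) (hσ0 t') (hσ t).ge (hσ t').le
  obtain ⟨t, -, htfix⟩ := exists_fixedPoint_of_monotoneOn_Icc (h := fun t => τ (σ t)) hR0.le
    (fun x hx y _ hxy => hτm (hσ0 x).le (hσm hx.1 hxy))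
    (fun x hx => ⟨(hτ0 _).le, hτR (hσ0 x).le (hσR hx.1 hx.2)⟩)
  have h1 := hτ (σ t)
  rw [htfix] at h1
  exact ⟨t, htfix ▸ hτ0 (σ t), σ t, hσ0 t, by linarith, by linarith [hσ t]⟩

section FiberMap

variable {f : ℝ → ℝ}

theorem tendsto_div_cube_atTop (hf : Continuous f)
    (hf3 : Tendsto (fun s : ℝ => (∫ t in (0:ℝ)..s, f t) / s ^ 4) (cocompact ℝ) atTop)
    (hf4 : ∀ t s : ℝ, (0 < t ∧ t < s) ∨ (s < t ∧ t < 0) → f t / t ^ 3 ≤ f s / s ^ 3) :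
    Tendsto (fun s : ℝ => f s / s ^ 3) (cocompact ℝ) atTop := by
  have hne : ∀ᶠ s : ℝ in cocompact ℝ, s ≠ 0 :=
    (Set.finite_singleton (0 : ℝ)).isCompact.compl_mem_cocompact
  refine tendsto_atTop_mono' _ ?_ (hf3.const_mul_atTop (r := 4) (by norm_num))
  filter_upwards [hne] with s hs
  have hs4 : 0 < s ^ 4 := by positivity
  have hint : ∫ t in (0:ℝ)..s, f t = ∫ r in (0:ℝ)..1, s * f (s * r) := by
    have := intervalIntegral.mul_integral_comp_mul_left (a := 0) (b := 1) (f := f) s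
    rw [intervalIntegral.integral_const_mul, this]
    simp
  have hle : ∫ r in (0:ℝ)..1, s * f (s * r) ≤ ∫ r in (0:ℝ)..1, f s / s ^ 3 * s ^ 4 * r ^ 3 := by
    refine intervalIntegral.integral_mono_on_of_le_Ioo zero_le_one
      (by apply Continuous.intervalIntegrable; fun_prop)
      (by apply Continuous.intervalIntegrable; fun_prop) fun r hr => ?_
    have hr0 : 0 < r := hr.1
    have hr1 : r < 1 := hr.2
    have hquot : f (s * r) / (s * r) ^ 3 ≤ f s / s ^ 3 := by
      apply hf4
      rcases hs.lt_or_gt with h | h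
      · exact Or.inr ⟨by nlinarith, by nlinarith⟩
      · exact Or.inl ⟨by positivity, by nlinarith⟩
    calc s * f (s * r) = f (s * r) / (s * r) ^ 3 * (s ^ 4 * r ^ 3) := by field_simp
      _ ≤ f s / s ^ 3 * (s ^ 4 * r ^ 3) := by gcongr
      _ = _ := by ring
  rw [intervalIntegral.integral_const_mul (f s / s ^ 3 * s ^ 4), integral_pow] at hle
  norm_num at hle
  rw [hint, ← mul_div_assoc, div_le_iff₀ hs4]
  linarith

theorem div_pow_four_mono
    (hf4 : ∀ t s : ℝ, (0 < t ∧ t < s) ∨ (s < t ∧ t < 0) → f t / t ^ 3 ≤ f s / s ^ 3)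
    (x : ℝ) {t t' : ℝ} (ht : 0 < t) (htt' : t ≤ t') :
    f (t * x) * (t * x) / t ^ 4 ≤ f (t' * x) * (t' * x) / t' ^ 4 := by
  obtain rfl | hlt := htt'.eq_or_lt
  · exact le_rfl
  have ht' := ht.trans hlt
  obtain rfl | hx := eq_or_ne x 0
  · simp
  have key (r : ℝ) (hr : 0 < r) : f (r * x) * (r * x) / r ^ 4 = f (r * x) / (r * x) ^ 3 * x ^ 4 := by
    field_simp
  rw [key t ht, key t' ht']
  gcongr ?_ * _
  apply hf4
  rcases hx.lt_or_gt with h | h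
  · exact Or.inr ⟨by nlinarith, by nlinarith⟩
  · exact Or.inl ⟨by positivity, by nlinarith⟩

theorem eventually_abs_mul_self_le
    (hf1 : Tendsto (fun s : ℝ => f s / s) (𝓝[≠] 0) (𝓝 0)) {ε : ℝ} (hε : 0 < ε) :
    ∀ᶠ s in 𝓝 (0 : ℝ), |f s * s| ≤ ε * s ^ 2 := by
  have h := eventually_nhdsWithin_iff.1 (hf1.abs.eventually_lt_const (by simpa using hε))
  filter_upwards [h] with s hs
  obtain rfl | h0 := eq_or_ne s 0
  · simp
  have := hs h0
  rw [abs_div, div_lt_iff₀ (abs_pos.2 h0)] at this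
  rw [abs_mul, ← sq_abs s]
  nlinarith [abs_nonneg s]

variable {X : Type*} [TopologicalSpace X] [MeasurableSpace X] [BorelSpace X] {μ : Measure X}
  [IsLocallyFiniteMeasure μ] [μ.IsOpenPosMeasure] {u : X → ℝ}

theorem isFiberMap_integral (hf : Continuous f)
    (hf1 : Tendsto (fun s : ℝ => f s / s) (𝓝[≠] 0) (𝓝 0))
    (hf3 : Tendsto (fun s : ℝ => (∫ t in (0:ℝ)..s, f t) / s ^ 4) (cocompact ℝ) atTop)
    (hf4 : ∀ t s : ℝ, (0 < t ∧ t < s) ∨ (s < t ∧ t < 0) → f t / t ^ 3 ≤ f s / s ^ 3)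
    (hu : Continuous u) (hsupp : HasCompactSupport u) (hu0 : u ≠ 0) :
    IsFiberMap fun t => ∫ x, f (t * u x) * (t * u x) ∂μ := by
  have hint (t : ℝ) : Integrable (fun x => f (t * u x) * (t * u x)) μ :=
    (show Continuous fun x => f (t * u x) * (t * u x) by fun_prop).integrable_of_hasCompactSupport
      (hsupp.mul_left.mul_left)
  have hmono (t t' : ℝ) (ht : 0 < t) (htt' : t ≤ t') (x : X) :=
    div_pow_four_mono hf4 (u x) ht htt'
  refine ⟨?_, fun t t' ht htt' => ?_, ?_, ?_⟩
  · have heq (t : ℝ) : ∫ x in tsupport u, f (t * u x) * (t * u x) ∂μ =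
        ∫ x, f (t * u x) * (t * u x) ∂μ :=
      setIntegral_eq_integral_of_forall_compl_eq_zero fun x hx => by
        simp [image_eq_zero_of_notMem_tsupport hx]
    simp_rw [← heq]
    exact continuous_parametric_integral_of_continuous (by fun_prop) hsupp
  · simp_rw [← MeasureTheory.integral_div]
    exact integral_mono ((hint t).div_const _) ((hint t').div_const _) (hmono t t' ht htt')
  · rw [Metric.tendsto_nhds]
    intro ε hε
    have hu2 : Integrable (fun x => u x ^ 2) μ :=
      (hu.pow 2).integrable_of_hasCompactSupport (by simpa [pow_two] using hsupp.mul_left (f' := u))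
    set K := ∫ x, u x ^ 2 ∂μ with hK
    have hK0 : 0 ≤ K := integral_nonneg fun x => sq_nonneg _
    obtain ⟨M, hM⟩ := hsupp.exists_bound_of_continuous hu
    obtain ⟨δ, hδ, hball⟩ := Metric.eventually_nhds_iff.1
      (eventually_abs_mul_self_le hf1 (show 0 < ε / (K + 1) by positivity))
    filter_upwards [Ioo_mem_nhdsGT (show 0 < δ / (|M| + 1) by positivity)] with t ht
    obtain ⟨ht0, htδ⟩ := ht
    rw [lt_div_iff₀ (by positivity)] at htδ
    have hbound : ‖∫ x, f (t * u x) * (t * u x) ∂μ‖ ≤ ∫ x, ε / (K + 1) * t ^ 2 * u x ^ 2 ∂μ := by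
      refine norm_integral_le_of_norm_le (hu2.const_mul _) (.of_forall fun x => ?_)
      have hx : dist (t * u x) 0 < δ := by
        rw [Real.dist_0_eq_abs, abs_mul, abs_of_pos ht0]
        have : |u x| ≤ |M| := (hM x).trans (le_abs_self M)
        nlinarith
      have := hball hx
      rwa [mul_pow, ← mul_assoc (ε / (K + 1))] at this
    rw [MeasureTheory.integral_const_mul, ← hK] at hbound
    rw [Real.dist_0_eq_abs, abs_div, abs_of_pos (by positivity : 0 < t ^ 2),
      div_lt_iff₀ (by positivity)]
    refine hbound.trans_lt ?_
    have : ε / (K + 1) * K < ε := by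
      rw [div_mul_eq_mul_div, div_lt_iff₀ (by positivity)]
      nlinarith
    have : 0 < t ^ 2 := by positivity
    nlinarith
  · obtain ⟨x₀, hx₀⟩ := Function.ne_iff.1 hu0
    have hm : 0 < |u x₀| / 2 := by have := abs_pos.2 hx₀; positivity
    set m := |u x₀| / 2 with hmdef
    set U := {x | m < |u x|} with hU
    have hUo : IsOpen U := isOpen_lt continuous_const hu.abs
    have hUfin : μ U < ⊤ := (measure_mono fun x hx => subset_tsupport u
      (abs_pos.1 (hm.trans hx))).trans_lt hsupp.isCompact.measure_lt_top
    have hUpos : 0 < μ.real U := ENNReal.toReal_pos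
      (hUo.measure_pos μ ⟨x₀, by simp only [hU, Set.mem_ofPred_eq]; linarith⟩).ne' hUfin.ne
    set B := ∫ x, |f (1 * u x) * (1 * u x)| ∂μ with hB
    refine tendsto_atTop.2 fun b => ?_
    set C := (|b| + B) / (m ^ 4 * μ.real U) with hC
    have hB0 : 0 ≤ B := integral_nonneg fun x => abs_nonneg _
    have hC0 : 0 ≤ C := by positivity
    obtain ⟨R, -, hR⟩ := (hasBasis_cobounded_norm (E := ℝ)).eventually_iff.1
      (Metric.cobounded_eq_cocompact (α := ℝ) ▸
        (tendsto_div_cube_atTop hf hf3 hf4).eventually_ge_atTop C)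
    filter_upwards [eventually_ge_atTop 1, eventually_ge_atTop (R / m)] with t ht1 htR
    have ht0 : 0 < t := by linarith
    rw [div_le_iff₀ hm] at htR
    have hlow : ∫ x, (U.indicator (fun _ => C * m ^ 4) x - |f (1 * u x) * (1 * u x)|) ∂μ ≤
        ∫ x, f (t * u x) * (t * u x) / t ^ 4 ∂μ := by
      refine integral_mono (((integrable_indicator_iff hUo.measurableSet).2
        (integrableOn_const hUfin.ne)).sub (hint 1).abs)
        ((hint t).div_const _) fun x => ?_
      by_cases hx : x ∈ U
      · have hxm : m < |u x| := hx
        have hux : u x ≠ 0 := abs_pos.1 (hm.trans hxm)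
        have hq : C ≤ f (t * u x) / (t * u x) ^ 3 := by
          refine hR ?_
          simp only [Set.mem_ofPred_eq, Real.norm_eq_abs, abs_mul, abs_of_pos ht0]
          nlinarith
        have hpow : m ^ 4 ≤ u x ^ 4 := by
          rw [← (by decide : Even 4).pow_abs (u x)]
          gcongr
        simp only [Set.indicator_of_mem hx]
        calc _ ≤ C * m ^ 4 := by linarith [abs_nonneg (f (1 * u x) * (1 * u x))]
          _ ≤ f (t * u x) / (t * u x) ^ 3 * u x ^ 4 :=
            mul_le_mul hq hpow (by positivity) (hC0.trans hq)
          _ = _ := by field_simp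
      · simp only [Set.indicator_of_notMem hx]
        have := hmono 1 t one_pos ht1 x
        have := neg_abs_le (f (1 * u x) * (1 * u x))
        simp only [one_pow, div_one] at *
        linarith
    rw [integral_sub ((integrable_indicator_iff hUo.measurableSet).2
      (integrableOn_const hUfin.ne)) (hint 1).abs, MeasureTheory.integral_indicator hUo.measurableSet,
      setIntegral_const, smul_eq_mul, MeasureTheory.integral_div, ← hB] at hlow
    have : μ.real U * (C * m ^ 4) = |b| + B := by rw [hC]; field_simp
    linarith [le_abs_self b]

end FiberMap

theorem Dcoul_nonneg (g h : EuclideanSpace ℝ (Fin 3) → ℝ) : 0 ≤ Dcoul g h :=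
  mul_nonneg (by positivity) (integral_nonneg fun _ => integral_nonneg fun _ => by positivity)

theorem setIntegral_energyDensity_pos {V v : EuclideanSpace ℝ (Fin 3) → ℝ} (hVmeas : Measurable V)
    {α Vinf : ℝ} (hα : 0 < α) (hV : ∀ x, α ≤ V x ∧ V x ≤ Vinf) (hv : ContDiff ℝ 1 v)
    (hvsupp : HasCompactSupport v) {S : Set (EuclideanSpace ℝ (Fin 3))} (hS : IsOpen S)
    (hne : S.Nonempty) (hvS : ∀ x ∈ S, v x ≠ 0) :
    0 < ∫ x in S, (‖fderiv ℝ v x‖ ^ 2 + V x * (v x) ^ 2) := by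
  have hv2 : Integrable (fun x => v x ^ 2) :=
    (hv.continuous.pow 2).integrable_of_hasCompactSupport
      (by simpa [pow_two] using hvsupp.mul_left (f' := v))
  have hVv : Integrable (fun x => V x * v x ^ 2) := by
    refine (hv2.const_mul Vinf).mono' (hVmeas.aestronglyMeasurable.mul hv2.1)
      (.of_forall fun x => ?_)
    have hVx : 0 < V x := hα.trans_le (hV x).1
    rw [Real.norm_of_nonneg (by positivity)]
    exact mul_le_mul_of_nonneg_right (hV x).2 (sq_nonneg _)
  have hgrad : Integrable (fun x => ‖fderiv ℝ v x‖ ^ 2) :=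
    ((hv.continuous_fderiv one_ne_zero).norm.pow 2).integrable_of_hasCompactSupport
      (by simpa [pow_two] using (hvsupp.fderiv ℝ).norm.mul_left (f' := fun x => ‖fderiv ℝ v x‖))
  have hpos (x) : 0 ≤ ‖fderiv ℝ v x‖ ^ 2 + V x * v x ^ 2 := by
    have hVx : 0 < V x := hα.trans_le (hV x).1
    positivity
  rw [setIntegral_pos_iff_support_of_nonneg_ae (.of_forall hpos) (hgrad.add hVv).integrableOn]
  refine (hS.measure_pos volume hne).trans_le (measure_mono fun x hx => ⟨ne_of_gt ?_, hx⟩)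
  have hVx : 0 < V x := hα.trans_le (hV x).1
  have := hvS x hx
  positivity

/-- Let `f` be `C¹` satisfying `(f₁)–(f₄)` and `V` measurable with
`0 < α ≤ V ≤ V_∞`. Let `v` be `C¹`, compactly supported, with `v⁺ ≠ 0` and `v⁻ ≠ 0`.
With `a± = ∫_{±v>0} (|∇v|² + V v²)`, there exist `t, s > 0` with
`t² a⁺ + t⁴ D(v⁺,v⁺) + t² s² D(v⁺,v⁻) = ∫ f(t v⁺) t v⁺` and
`s² a⁻ + s⁴ D(v⁻,v⁻) + t² s² D(v⁻,v⁺) = ∫ f(s v⁻) s v⁻`; moreover, if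
`a⁺ + D(v⁺,v⁺) + D(v⁺,v⁻) ≤ ∫ f(v⁺) v⁺` and `a⁻ + D(v⁻,v⁻) + D(v⁻,v⁺) ≤ ∫ f(v⁻) v⁻`,
then `t ≤ 1` and `s ≤ 1`. -/
theorem nodal_Nehari_projection
    (f : ℝ → ℝ) (hf : ContDiff ℝ 1 f)
    (hf1 : Tendsto (fun s : ℝ => f s / s) (𝓝[≠] 0) (𝓝 0))
    (hf2 : Tendsto (fun s : ℝ => f s / |s| ^ 5) (cocompact ℝ) (𝓝 0))
    (hf3 : Tendsto (fun s : ℝ => (∫ t in (0:ℝ)..s, f t) / s ^ 4) (cocompact ℝ) atTop)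
    (hf4 : ∀ t s : ℝ, (0 < t ∧ t < s) ∨ (s < t ∧ t < 0) → f t / t ^ 3 ≤ f s / s ^ 3)
    (V : EuclideanSpace ℝ (Fin 3) → ℝ) (hVmeas : Measurable V)
    (α Vinf : ℝ) (hα : 0 < α) (hV : ∀ x, α ≤ V x ∧ V x ≤ Vinf)
    (v : EuclideanSpace ℝ (Fin 3) → ℝ)
    (hv : ContDiff ℝ 1 v) (hvsupp : HasCompactSupport v)
    (hvp : (fun x => max (v x) 0) ≠ 0) (hvm : (fun x => min (v x) 0) ≠ 0) :
    ∃ t > (0:ℝ), ∃ s > (0:ℝ),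
      (t ^ 2 * (∫ x in {x : EuclideanSpace ℝ (Fin 3) | 0 < v x},
            (‖fderiv ℝ v x‖ ^ 2 + V x * (v x) ^ 2))
          + t ^ 4 * Dcoul (fun x => max (v x) 0) (fun x => max (v x) 0)
          + t ^ 2 * s ^ 2 * Dcoul (fun x => max (v x) 0) (fun x => min (v x) 0)
        = ∫ x : EuclideanSpace ℝ (Fin 3), f (t * max (v x) 0) * (t * max (v x) 0)) ∧
      (s ^ 2 * (∫ x in {x : EuclideanSpace ℝ (Fin 3) | v x < 0},
            (‖fderiv ℝ v x‖ ^ 2 + V x * (v x) ^ 2))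
          + s ^ 4 * Dcoul (fun x => min (v x) 0) (fun x => min (v x) 0)
          + t ^ 2 * s ^ 2 * Dcoul (fun x => min (v x) 0) (fun x => max (v x) 0)
        = ∫ x : EuclideanSpace ℝ (Fin 3), f (s * min (v x) 0) * (s * min (v x) 0)) ∧
      (((∫ x in {x : EuclideanSpace ℝ (Fin 3) | 0 < v x},
            (‖fderiv ℝ v x‖ ^ 2 + V x * (v x) ^ 2))
            + Dcoul (fun x => max (v x) 0) (fun x => max (v x) 0)
            + Dcoul (fun x => max (v x) 0) (fun x => min (v x) 0)
          ≤ (∫ x : EuclideanSpace ℝ (Fin 3), f (max (v x) 0) * max (v x) 0)) →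
       ((∫ x in {x : EuclideanSpace ℝ (Fin 3) | v x < 0},
            (‖fderiv ℝ v x‖ ^ 2 + V x * (v x) ^ 2))
            + Dcoul (fun x => min (v x) 0) (fun x => min (v x) 0)
            + Dcoul (fun x => min (v x) 0) (fun x => max (v x) 0)
          ≤ (∫ x : EuclideanSpace ℝ (Fin 3), f (min (v x) 0) * min (v x) 0)) →
       t ≤ 1 ∧ s ≤ 1) := by
  have hvc := hv.continuous
  have hp0 : {x | 0 < v x}.Nonempty := by
    obtain ⟨x, hx⟩ := Function.ne_iff.1 hvp
    exact ⟨x, by by_contra h; exact hx (max_eq_right (not_lt.1 h))⟩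
  have hm0 : {x | v x < 0}.Nonempty := by
    obtain ⟨x, hx⟩ := Function.ne_iff.1 hvm
    exact ⟨x, by by_contra h; exact hx (min_eq_right (not_lt.1 h))⟩
  have hap := setIntegral_energyDensity_pos hVmeas hα hV hv hvsupp
    (isOpen_lt continuous_const hvc) hp0 fun x hx => ne_of_gt hx
  have ham := setIntegral_energyDensity_pos hVmeas hα hV hv hvsupp
    (isOpen_lt hvc continuous_const) hm0 fun x hx => ne_of_lt hx
  have hpc : Continuous fun x => max (v x) 0 := hvc.max continuous_const
  have hmc : Continuous fun x => min (v x) 0 := hvc.min continuous_const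
  have hps : HasCompactSupport fun x => max (v x) 0 :=
    hvsupp.comp_left (g := fun y : ℝ => max y 0) (max_self 0)
  have hms : HasCompactSupport fun x => min (v x) 0 :=
    hvsupp.comp_left (g := fun y : ℝ => min y 0) (min_self 0)
  have hHp := isFiberMap_integral (μ := volume) hf.continuous hf1 hf3 hf4 hpc hps hvp
  have hHm := isFiberMap_integral (μ := volume) hf.continuous hf1 hf3 hf4 hmc hms hvm
  obtain ⟨t, ht, s, hs, h1, h2⟩ := exists_coupled_root hHp hHm
    hap (Dcoul_nonneg (fun x => max (v x) 0) (fun x => max (v x) 0))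
    (Dcoul_nonneg (fun x => max (v x) 0) (fun x => min (v x) 0))
    ham (Dcoul_nonneg (fun x => min (v x) 0) (fun x => min (v x) 0))
    (Dcoul_nonneg (fun x => min (v x) 0) (fun x => max (v x) 0))
  refine ⟨t, ht, s, hs, h1, h2, fun hp hm => ?_⟩
  rcases le_total s t with hst | hst
  · have ht1 := hHp.le_one_of_coupled hap (Dcoul_nonneg _ _) ht hs hst h1
      (by simpa only [one_mul] using hp)
    exact ⟨ht1, hst.trans ht1⟩
  · have hs1 := hHm.le_one_of_coupled ham (Dcoul_nonneg _ _) hs ht hst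
      (by rwa [mul_comm (t ^ 2)] at h2) (by simpa only [one_mul] using hm)
    exact ⟨hst.trans hs1, hs1⟩
end
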